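/- Let P be a finite subset of Euclidean space R^n and α > 0. Then the Vietoris–Rips complex R_α(P) is a subcomplex of the Čech complex C_{sα}(P) with s = sqrt(2n/(n+1)). In particular, R_α(P) ⊆ C_{√2 α}(P) for any n. -/

import Mathlib

/-- The Čech complex of `P` at scale `α`: the nerve of the closed balls of radius
`α` centered at points of `P`. -/
def cechComplex {X : Type*} [MetricSpace X] (α : ℝ) (P : Set X) : Set (Finset X) :=
  {σ | σ.Nonempty ∧ ↑σ ⊆ P ∧ (⋂ x ∈ σ, Metric.closedBall x α).Nonempty}

/-- The Vietoris–Rips complex of `P` at scale `α`. -/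
def ripsComplex {X : Type*} [MetricSpace X] (α : ℝ) (P : Set X) : Set (Finset X) :=
  {σ | σ.Nonempty ∧ ↑σ ⊆ P ∧ ∀ x ∈ σ, ∀ y ∈ σ, dist x y ≤ 2 * α}

open Finset in
/-- Jung's bound for a finite family of points, in terms of the number of points. -/
theorem jung_aux {E ι : Type*} [NormedAddCommGroup E] [InnerProductSpace ℝ E] [Fintype ι]
    [DecidableEq ι] [Nonempty ι] (x : ι → E) (α : ℝ)
    (h : ∀ i j, dist (x i) (x j) ≤ 2 * α) :
    ∃ c, ∀ i, ‖x i - c‖ ^ 2 ≤ 2 * α ^ 2 * (1 - 1 / (Fintype.card ι : ℝ)) := by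
  let f : (ι → ℝ) → ℝ := fun w => ∑ i, w i * ‖x i‖ ^ 2 - ‖∑ i, w i • x i‖ ^ 2
  have hf : Continuous f := by fun_prop
  obtain ⟨w, hw, hmax⟩ := (isCompact_stdSimplex ℝ ι).exists_isMaxOn
    ⟨_, single_mem_stdSimplex ℝ (Classical.arbitrary ι)⟩ hf.continuousOn
  have hw0 : ∀ i, 0 ≤ w i := hw.1
  have hw1 : ∑ i, w i = 1 := hw.2
  have hα : 0 ≤ α := by
    have := (dist_nonneg).trans (h (Classical.arbitrary ι) (Classical.arbitrary ι))
    linarith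
  refine ⟨∑ i, w i • x i, fun k => ?_⟩
  -- first-order optimality
  have key : ‖x k - ∑ i, w i • x i‖ ^ 2 ≤ f w := by
    have hmix : ∀ t ∈ Set.Ioo (0 : ℝ) 1, (1 - t) * ‖x k - ∑ i, w i • x i‖ ^ 2 ≤ f w := by
      intro t ht
      have hg : (1 - t) • w + t • (Pi.single k 1 : ι → ℝ) ∈ stdSimplex ℝ ι :=
        convex_stdSimplex ℝ ι hw (single_mem_stdSimplex ℝ k) (by linarith [ht.2]) ht.1.le (by ring)
      have h1 : f ((1 - t) • w + t • (Pi.single k 1 : ι → ℝ)) ≤ f w := hmax hg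
      have e1 : ∑ i, ((1 - t) • w + t • (Pi.single k 1 : ι → ℝ)) i * ‖x i‖ ^ 2
          = (1 - t) * ∑ i, w i * ‖x i‖ ^ 2 + t * ‖x k‖ ^ 2 := by
        simp [add_mul, sum_add_distrib, mul_sum, mul_assoc, Pi.single_apply]
      have e2 : ∑ i, ((1 - t) • w + t • (Pi.single k 1 : ι → ℝ)) i • x i
          = (1 - t) • ∑ i, w i • x i + t • x k := by
        simp [add_smul, sum_add_distrib, smul_sum, mul_smul, Pi.single_apply]
      simp only [f] at h1 ⊢
      rw [e1, e2] at h1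
      generalize (∑ i, w i • x i) = c at *
      generalize (∑ i, w i * ‖x i‖ ^ 2) = A at *
      rw [norm_add_sq_real, norm_smul, norm_smul, mul_pow, mul_pow, inner_smul_left,
        inner_smul_right, Real.norm_eq_abs, Real.norm_eq_abs, sq_abs, sq_abs] at h1
      simp only [conj_trivial] at h1
      rw [norm_sub_sq_real, real_inner_comm]
      have : t * ((1 - t) * (‖x k‖ ^ 2 - 2 * inner ℝ c (x k) + ‖c‖ ^ 2)) ≤
          t * (A - ‖c‖ ^ 2) := by nlinarith
      exact le_of_mul_le_mul_left this ht.1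
    by_contra! hlt
    have hfn : 0 ≤ f w := by
      have := hmix (1/2) ⟨by norm_num, by norm_num⟩
      nlinarith [sq_nonneg ‖x k - ∑ i, w i • x i‖]
    generalize ‖x k - ∑ i, w i • x i‖ ^ 2 = D at *
    have hD : 0 < D := hfn.trans_lt hlt
    have := hmix ((D - f w) / (2 * D + 1)) ⟨by apply div_pos <;> linarith, by
      rw [div_lt_one] <;> linarith⟩
    have e : (1 - (D - f w) / (2 * D + 1)) * D = D - (D - f w) * (D / (2 * D + 1)) := by
      field_simp
    have e' : D / (2 * D + 1) < 1 := by rw [div_lt_one] <;> linarith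
    nlinarith
  refine key.trans ?_
  have hvar : f w = 1 / 2 * ∑ i, ∑ j, w i * w j * ‖x i - x j‖ ^ 2 := by
    have e2 : ‖∑ i, w i • x i‖ ^ 2 = ∑ i, ∑ j, w i * w j * inner ℝ (x i) (x j) := by
      rw [← real_inner_self_eq_norm_sq]
      simp only [sum_inner, inner_sum, inner_smul_left, inner_smul_right, mul_assoc, conj_trivial, mul_sum]
      refine sum_congr rfl fun i _ => sum_congr rfl fun j _ => ?_
      rw [real_inner_comm]
    have e3 : ∑ i, ∑ j, w i * w j * ‖x i‖ ^ 2 = ∑ i, w i * ‖x i‖ ^ 2 := by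
      refine sum_congr rfl fun i _ => ?_
      rw [← sum_mul, ← mul_sum, hw1, mul_one]
    have e4 : ∑ i, ∑ j, w i * w j * ‖x j‖ ^ 2 = ∑ i, w i * ‖x i‖ ^ 2 := by
      rw [sum_comm]
      refine sum_congr rfl fun i _ => ?_
      rw [← sum_mul, ← sum_mul, hw1, one_mul]
    have e5 : ∑ i, ∑ j, w i * w j * ‖x i - x j‖ ^ 2 =
        ∑ i, ∑ j, w i * w j * ‖x i‖ ^ 2 - 2 * ∑ i, ∑ j, w i * w j * inner ℝ (x i) (x j)
          + ∑ i, ∑ j, w i * w j * ‖x j‖ ^ 2 := by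
      simp only [mul_sum, ← sum_sub_distrib, ← sum_add_distrib]
      refine sum_congr rfl fun i _ => sum_congr rfl fun j _ => ?_
      rw [norm_sub_sq_real]; ring
    simp only [f]
    rw [e5, e3, e4, e2]; ring
  have hle : ∑ i, ∑ j, w i * w j * ‖x i - x j‖ ^ 2 ≤
      ∑ i, ∑ j, (4 * α ^ 2 * (w i * w j) - if i = j then 4 * α ^ 2 * (w i * w j) else 0) := by
    refine sum_le_sum fun i _ => sum_le_sum fun j _ => ?_
    have hij := h i j
    rw [dist_eq_norm] at hij
    split_ifs with hh
    · subst hh; simp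
    · have : ‖x i - x j‖ ^ 2 ≤ (2 * α) ^ 2 := pow_le_pow_left₀ (norm_nonneg _) hij 2
      nlinarith [mul_nonneg (hw0 i) (hw0 j)]
  have heq : ∑ i, ∑ j, (4 * α ^ 2 * (w i * w j) - if i = j then 4 * α ^ 2 * (w i * w j) else 0)
      = 4 * α ^ 2 * (1 - ∑ i, w i ^ 2) := by
    simp only [sum_sub_distrib, sum_ite_eq, mem_univ, if_true, ← mul_sum, ← sum_mul, hw1, sq]
    ring
  have hcs : (1 : ℝ) / Fintype.card ι ≤ ∑ i, w i ^ 2 := by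
    have := sq_sum_le_card_mul_sum_sq (s := (univ : Finset ι)) (f := w)
    rw [hw1, card_univ] at this
    have hc : (0 : ℝ) < Fintype.card ι := by exact_mod_cast Fintype.card_pos
    rw [div_le_iff₀ hc]; linarith
  rw [hvar]
  rw [heq] at hle
  nlinarith [sq_nonneg α]

/-- Jung's theorem for finite sets. -/
theorem jung_finite (n : ℕ) (σ : Finset (EuclideanSpace ℝ (Fin n))) (α : ℝ) (hα : 0 < α)
    (h : ∀ x ∈ σ, ∀ y ∈ σ, dist x y ≤ 2 * α) :
    (⋂ x ∈ σ, Metric.closedBall x (Real.sqrt (2 * n / (n + 1)) * α)).Nonempty := by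
  classical
  refine Convex.helly_theorem' (𝕜 := ℝ) (fun i _ => convex_closedBall _ _) ?_
  intro I hI hcard
  rw [finrank_euclideanSpace_fin] at hcard
  rcases I.eq_empty_or_nonempty with rfl | hne
  · simp
  have : Nonempty I := hne.to_subtype
  obtain ⟨c, hc⟩ := jung_aux (fun i : I => (i : EuclideanSpace ℝ (Fin n))) α
    (fun i j => h _ (hI i.2) _ (hI j.2))
  refine ⟨c, ?_⟩
  simp only [Set.mem_iInter, Metric.mem_closedBall]
  intro i hi
  have h1 := hc ⟨i, hi⟩
  rw [dist_comm, dist_eq_norm]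
  refine (sq_le_sq₀ (norm_nonneg _) (by positivity)).1 (h1.trans ?_)
  rw [mul_pow, Real.sq_sqrt (by positivity), Fintype.card_coe]
  have hp : (0 : ℝ) < I.card := by exact_mod_cast hne.card_pos
  have hle : (I.card : ℝ) ≤ n + 1 := by exact_mod_cast hcard
  have h2 : 1 / ((n : ℝ) + 1) ≤ 1 / I.card := one_div_le_one_div_of_le hp hle
  have h3 : 2 * (n : ℝ) / (n + 1) = 2 * (1 - 1 / (n + 1)) := by field_simp; ring
  rw [h3]
  nlinarith [sq_nonneg α]

/-- In Euclidean space `ℝⁿ`, `R_α(P) ⊆ C_{sα}(P)` with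
`s = √(2n/(n+1))`; in particular `R_α(P) ⊆ C_{√2·α}(P)` for any `n`. -/
theorem stmt6 (n : ℕ) (P : Set (EuclideanSpace ℝ (Fin n))) (hP : P.Finite)
    (α : ℝ) (hα : 0 < α) :
    ripsComplex α P ⊆ cechComplex (Real.sqrt (2 * n / (n + 1)) * α) P ∧
    ripsComplex α P ⊆ cechComplex (Real.sqrt 2 * α) P := by
  have main : ripsComplex α P ⊆ cechComplex (Real.sqrt (2 * n / (n + 1)) * α) P :=
    fun σ hσ => ⟨hσ.1, hσ.2.1, jung_finite n σ α hα hσ.2.2⟩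
  refine ⟨main, fun σ hσ => ⟨hσ.1, hσ.2.1, (main hσ).2.2.mono ?_⟩⟩
  refine Set.iInter₂_mono fun x _ => Metric.closedBall_subset_closedBall ?_
  refine mul_le_mul_of_nonneg_right (Real.sqrt_le_sqrt ?_) hα.le
  rw [div_le_iff₀ (by positivity)]
  linarith
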